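/- Fix a finite POMDP with nonnegative rewards (r x a ≥ 0 for all x, a). Fix k ≥ 1, a belief b₀, actions a₀, …, a_{k−1}, and allowed observation sets Z̄₁, …, Z̄_k ⊆ Z. Let φ₀ = b₀, φ_{j+1} = φ_j · a_j and X^R_j = {x : φ_j x > 0}, and assume (O x) z > 0 for every j ∈ {1, …, k}, every x ∈ X^R_j and every z ∈ Z̄_j. Define C̄_k = ∏_{j=1}^k (min {(O x) z : z ∈ Z̄_j, x ∈ X^R_j}) / (max {(O x) z : z ∈ Z̄_j, x ∈ X^R_j}). Then for every observation sequence with z_j ∈ Z̄_j for all j, the posterior beliefs b_j = (b_{j−1})^{a_{j−1}, z_j} are well-defined, and for every horizon L ≥ 1 and every action a_k: C̄_k * Q^{OL} L φ_k a_k ≤ Q L b_k a_k ≤ (1 / C̄_k) * Q^{FO} L φ_k a_k. (Theorem 5: refined bounds under an allowed observation set.) -/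

import Mathlib

open Finset

set_option maxHeartbeats 1000000

attribute [local instance] Classical.propDecidable

/-- A finite POMDP: transition kernel, observation kernel and reward. -/
structure POMDP (X A Z : Type) where
  T : X → A → PMF X
  O : X → PMF Z
  r : X → A → ℝ

namespace POMDP

variable {X A Z : Type} [Fintype X] [Fintype A] [Fintype Z]
variable [Nonempty X] [Nonempty A] [Nonempty Z]

/-- Real-valued transition probability. -/
noncomputable def Tr (M : POMDP X A Z) (x : X) (a : A) (x' : X) : ℝ :=
  ((M.T x a) x').toReal

/-- Real-valued observation probability. -/
noncomputable def Ob (M : POMDP X A Z) (x : X) (z : Z) : ℝ :=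
  ((M.O x) z).toReal

/-- A belief: nonnegative and sums to one. -/
def IsBelief (b : X → ℝ) : Prop :=
  (∀ x, 0 ≤ b x) ∧ ∑ x, b x = 1

/-- The propagated belief `b·a`. -/
noncomputable def prop (M : POMDP X A Z) (b : X → ℝ) (a : A) : X → ℝ :=
  fun x' => ∑ x, b x * M.Tr x a x'

/-- Expected reward `R(b,a)`. -/
noncomputable def Rew (M : POMDP X A Z) (b : X → ℝ) (a : A) : ℝ :=
  ∑ x, b x * M.r x a

/-- Observation likelihood `P(z ∣ b, a)`. -/
noncomputable def obsLik (M : POMDP X A Z) (z : Z) (b : X → ℝ) (a : A) : ℝ :=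
  ∑ x', M.prop b a x' * M.Ob x' z

/-- Bayes posterior `b^{a,z}`. -/
noncomputable def post (M : POMDP X A Z) (b : X → ℝ) (a : A) (z : Z) : X → ℝ :=
  fun x' => M.Ob x' z * M.prop b a x' / M.obsLik z b a

/-- Closed-loop optimal value `V`. -/
noncomputable def V (M : POMDP X A Z) : ℕ → (X → ℝ) → ℝ
  | 0, _ => 0
  | n + 1, b =>
    Finset.univ.sup' Finset.univ_nonempty fun a =>
      M.Rew b a +
        ∑ z ∈ Finset.univ.filter (fun z => 0 < M.obsLik z b a),
          M.obsLik z b a * V M n (M.post b a z)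

/-- Closed-loop optimal Q-function `Q`. -/
noncomputable def Q (M : POMDP X A Z) : ℕ → (X → ℝ) → A → ℝ
  | 0, _, _ => 0
  | n + 1, b, a =>
    M.Rew b a +
      ∑ z ∈ Finset.univ.filter (fun z => 0 < M.obsLik z b a),
        M.obsLik z b a * V M n (M.post b a z)

/-- Open-loop optimal value `W`. -/
noncomputable def W (M : POMDP X A Z) : ℕ → (X → ℝ) → ℝ
  | 0, _ => 0
  | n + 1, b =>
    Finset.univ.sup' Finset.univ_nonempty fun a =>
      M.Rew b a + W M n (M.prop b a)

/-- Open-loop Q-function `Q^{OL}`. -/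
noncomputable def QOL (M : POMDP X A Z) : ℕ → (X → ℝ) → A → ℝ
  | 0, _, _ => 0
  | n + 1, b, a => M.Rew b a + W M n (M.prop b a)

/-- Fully observable (MDP) optimal value `U`. -/
noncomputable def U (M : POMDP X A Z) : ℕ → X → ℝ
  | 0, _ => 0
  | n + 1, x =>
    Finset.univ.sup' Finset.univ_nonempty fun a =>
      M.r x a + ∑ x', M.Tr x a x' * U M n x'

/-- QMDP Q-function `Q^{FO}`. -/
noncomputable def QFO (M : POMDP X A Z) : ℕ → (X → ℝ) → A → ℝ
  | 0, _, _ => 0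
  | n + 1, b, a => M.Rew b a + ∑ x', M.prop b a x' * U M n x'

/-- Adaptive open-loop optimal value `V^{AOL}_β` on histories of actions and observations. -/
noncomputable def VAOL (M : POMDP X A Z) (β : List (A ⊕ Z) → Bool) :
    ℕ → (X → ℝ) → List (A ⊕ Z) → ℝ
  | 0, _, _ => 0
  | n + 1, b, h =>
    Finset.univ.sup' Finset.univ_nonempty fun a =>
      M.Rew b a +
        (if β h = true then VAOL M β n (M.prop b a) (h ++ [Sum.inl a])
        else
          ∑ z ∈ Finset.univ.filter (fun z => 0 < M.obsLik z b a),
            M.obsLik z b a * VAOL M β n (M.post b a z) (h ++ [Sum.inl a, Sum.inr z]))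

/-- Adaptive open-loop Q-function `Q^{AOL}_β`. -/
noncomputable def QAOL (M : POMDP X A Z) (β : List (A ⊕ Z) → Bool) :
    ℕ → (X → ℝ) → A → List (A ⊕ Z) → ℝ
  | 0, _, _, _ => 0
  | n + 1, b, a, h =>
    M.Rew b a +
      (if β h = true then VAOL M β n (M.prop b a) (h ++ [Sum.inl a])
      else
        ∑ z ∈ Finset.univ.filter (fun z => 0 < M.obsLik z b a),
          M.obsLik z b a * VAOL M β n (M.post b a z) (h ++ [Sum.inl a, Sum.inr z]))

/-- Point-mass belief at `x'`. -/
noncomputable def delta (x' : X) : X → ℝ := fun x => if x = x' then 1 else 0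

/-- Adaptive fully-observable optimal value `V^{AFO}_β` on histories of
actions, observations and states. -/
noncomputable def VAFO (M : POMDP X A Z) (β : List (A ⊕ (Z ⊕ X)) → Bool) :
    ℕ → (X → ℝ) → List (A ⊕ (Z ⊕ X)) → ℝ
  | 0, _, _ => 0
  | n + 1, b, h =>
    Finset.univ.sup' Finset.univ_nonempty fun a =>
      M.Rew b a +
        (if β h = true then
          ∑ x', M.prop b a x' *
            VAFO M β n (delta x') (h ++ [Sum.inl a, Sum.inr (Sum.inr x')])
        else
          ∑ z ∈ Finset.univ.filter (fun z => 0 < M.obsLik z b a),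
            M.obsLik z b a *
              VAFO M β n (M.post b a z) (h ++ [Sum.inl a, Sum.inr (Sum.inl z)]))

/-- Adaptive fully-observable Q-function `Q^{AFO}_β`. -/
noncomputable def QAFO (M : POMDP X A Z) (β : List (A ⊕ (Z ⊕ X)) → Bool) :
    ℕ → (X → ℝ) → A → List (A ⊕ (Z ⊕ X)) → ℝ
  | 0, _, _, _ => 0
  | n + 1, b, a, h =>
    M.Rew b a +
      (if β h = true then
        ∑ x', M.prop b a x' *
          VAFO M β n (delta x') (h ++ [Sum.inl a, Sum.inr (Sum.inr x')])
      else
        ∑ z ∈ Finset.univ.filter (fun z => 0 < M.obsLik z b a),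
          M.obsLik z b a *
            VAFO M β n (M.post b a z) (h ++ [Sum.inl a, Sum.inr (Sum.inl z)]))

/-- Depth-indexed adaptive open-loop value. -/
noncomputable def VAOLd (M : POMDP X A Z) (β : ℕ → Bool) : ℕ → ℕ → (X → ℝ) → ℝ
  | _, 0, _ => 0
  | d, n + 1, b =>
    Finset.univ.sup' Finset.univ_nonempty fun a =>
      M.Rew b a +
        (if β d = true then VAOLd M β (d + 1) n (M.prop b a)
        else
          ∑ z ∈ Finset.univ.filter (fun z => 0 < M.obsLik z b a),
            M.obsLik z b a * VAOLd M β (d + 1) n (M.post b a z))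

/-- Depth-indexed adaptive fully-observable value. -/
noncomputable def VAFOd (M : POMDP X A Z) (β : ℕ → Bool) : ℕ → ℕ → (X → ℝ) → ℝ
  | _, 0, _ => 0
  | d, n + 1, b =>
    Finset.univ.sup' Finset.univ_nonempty fun a =>
      M.Rew b a +
        (if β d = true then
          ∑ x', M.prop b a x' * VAFOd M β (d + 1) n (delta x')
        else
          ∑ z ∈ Finset.univ.filter (fun z => 0 < M.obsLik z b a),
            M.obsLik z b a * VAFOd M β (d + 1) n (M.post b a z))

/-- Open-loop propagated beliefs `φ₀ = b`, `φ_{i+1} = φ_i · a i` along a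
finite action sequence. -/
noncomputable def propFin (M : POMDP X A Z) (b : X → ℝ) {n : ℕ} (a : Fin n → A)
    (j : Fin (n + 1)) : X → ℝ :=
  Fin.induction b (fun i ih => M.prop ih (a i)) j

end POMDP

namespace POMDP

section aux

variable {X A Z : Type} [Fintype X] [Fintype A] [Fintype Z]
variable [Nonempty X] [Nonempty A] [Nonempty Z]

theorem aux_pmf_sum {Y : Type} [Fintype Y] (p : PMF Y) : ∑ y, (p y).toReal = 1 := by
  have h := p.tsum_coe
  rw [tsum_fintype] at h
  rw [← ENNReal.toReal_sum (fun y _ => p.apply_ne_top y), h]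
  simp

theorem aux_Tr_nonneg (M : POMDP X A Z) (x : X) (a : A) (x' : X) : 0 ≤ M.Tr x a x' :=
  ENNReal.toReal_nonneg

theorem aux_Ob_nonneg (M : POMDP X A Z) (x : X) (z : Z) : 0 ≤ M.Ob x z :=
  ENNReal.toReal_nonneg

theorem aux_Ob_sum (M : POMDP X A Z) (x : X) : ∑ z, M.Ob x z = 1 := aux_pmf_sum _

theorem aux_Tr_sum (M : POMDP X A Z) (x : X) (a : A) : ∑ x', M.Tr x a x' = 1 := aux_pmf_sum _

theorem aux_prop_nonneg (M : POMDP X A Z) (b : X → ℝ) (hb : ∀ x, 0 ≤ b x) (a : A) (x : X) :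
    0 ≤ M.prop b a x :=
  Finset.sum_nonneg fun y _ => mul_nonneg (hb y) (M.aux_Tr_nonneg y a x)

theorem aux_prop_sum (M : POMDP X A Z) (b : X → ℝ) (a : A) :
    ∑ x, M.prop b a x = ∑ x, b x := by
  unfold prop
  rw [Finset.sum_comm]
  simp [← Finset.mul_sum, aux_Tr_sum]

/-- weighted integration against the propagated belief -/
theorem aux_prop_mul (M : POMDP X A Z) (b : X → ℝ) (a : A) (f : X → ℝ) :
    ∑ x', M.prop b a x' * f x' = ∑ x, b x * ∑ x', M.Tr x a x' * f x' := by
  unfold prop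
  simp only [Finset.sum_mul, Finset.mul_sum]
  rw [Finset.sum_comm]
  simp only [mul_assoc]

theorem aux_prop_mono (M : POMDP X A Z) (c : ℝ) (b b' : X → ℝ) (h : ∀ x, c * b' x ≤ b x)
    (a : A) (x : X) : c * M.prop b' a x ≤ M.prop b a x := by
  unfold prop
  rw [Finset.mul_sum]
  refine Finset.sum_le_sum fun y _ => ?_
  rw [← mul_assoc]
  exact mul_le_mul_of_nonneg_right (h y) (M.aux_Tr_nonneg _ _ _)

theorem aux_Rew_mono (M : POMDP X A Z) (hr : ∀ x a, 0 ≤ M.r x a) (c : ℝ) (b b' : X → ℝ)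
    (h : ∀ x, c * b' x ≤ b x) (a : A) : c * M.Rew b' a ≤ M.Rew b a := by
  unfold Rew
  rw [Finset.mul_sum]
  refine Finset.sum_le_sum fun y _ => ?_
  rw [← mul_assoc]
  exact mul_le_mul_of_nonneg_right (h y) (hr _ _)

theorem aux_W_mono (M : POMDP X A Z) (hr : ∀ x a, 0 ≤ M.r x a) (c : ℝ) (n : ℕ) :
    ∀ (b b' : X → ℝ), (∀ x, c * b' x ≤ b x) → c * M.W n b' ≤ M.W n b := by
  induction n with
  | zero => intro b b' _; simp [W]
  | succ n ih =>
    intro b b' h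
    rw [W, W]
    obtain ⟨a, -, ha⟩ := Finset.exists_mem_eq_sup' (Finset.univ_nonempty (α := A))
      (fun a => M.Rew b' a + M.W n (M.prop b' a))
    rw [ha]
    refine le_trans ?_ (Finset.le_sup' _ (Finset.mem_univ a))
    rw [mul_add]
    exact add_le_add (M.aux_Rew_mono hr c b b' h a) (ih _ _ (M.aux_prop_mono c b b' h a))

theorem aux_W_sub (M : POMDP X A Z) {ι : Type} (s : Finset ι) (c : ι → ℝ)
    (hc : ∀ i ∈ s, 0 ≤ c i) (n : ℕ) : ∀ (b : ι → X → ℝ),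
    M.W n (fun x => ∑ i ∈ s, c i * b i x) ≤ ∑ i ∈ s, c i * M.W n (b i) := by
  induction n with
  | zero => intro b; simp [W]
  | succ n ih =>
    intro b
    rw [W]
    refine Finset.sup'_le _ _ fun a _ => ?_
    have h1 : M.Rew (fun x => ∑ i ∈ s, c i * b i x) a = ∑ i ∈ s, c i * M.Rew (b i) a := by
      unfold Rew
      simp only [Finset.sum_mul, Finset.mul_sum]
      rw [Finset.sum_comm]
      simp only [mul_assoc]
    have h2 : M.prop (fun x => ∑ i ∈ s, c i * b i x) a
        = fun x => ∑ i ∈ s, c i * M.prop (b i) a x := by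
      funext x
      unfold prop
      simp only [Finset.sum_mul, Finset.mul_sum]
      rw [Finset.sum_comm]
      simp only [mul_assoc]
    rw [h1, h2]
    refine (add_le_add_right (ih _) _).trans ?_
    rw [← Finset.sum_add_distrib]
    refine Finset.sum_le_sum fun i hi => ?_
    rw [← mul_add]
    refine mul_le_mul_of_nonneg_left ?_ (hc i hi)
    rw [W]
    exact Finset.le_sup' (fun a => M.Rew (b i) a + M.W n (M.prop (b i) a)) (Finset.mem_univ a)

theorem aux_obsLik_nonneg (M : POMDP X A Z) (b : X → ℝ) (hb : ∀ x, 0 ≤ b x) (a : A) (z : Z) :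
    0 ≤ M.obsLik z b a :=
  Finset.sum_nonneg fun x _ => mul_nonneg (M.aux_prop_nonneg b hb a x) (M.aux_Ob_nonneg x z)

theorem aux_post_nonneg (M : POMDP X A Z) (b : X → ℝ) (hb : ∀ x, 0 ≤ b x) (a : A) (z : Z)
    (x : X) : 0 ≤ M.post b a z x :=
  div_nonneg (mul_nonneg (M.aux_Ob_nonneg x z) (M.aux_prop_nonneg b hb a x))
    (M.aux_obsLik_nonneg b hb a z)

theorem aux_decomp (M : POMDP X A Z) (b : X → ℝ) (hb : ∀ x, 0 ≤ b x) (a : A) (x : X) :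
    ∑ z ∈ Finset.univ.filter (fun z => 0 < M.obsLik z b a),
      M.obsLik z b a * M.post b a z x = M.prop b a x := by
  have h : ∀ z, (if 0 < M.obsLik z b a then M.obsLik z b a * M.post b a z x else 0)
      = M.prop b a x * M.Ob x z := by
    intro z
    split_ifs with hz
    · unfold post
      field_simp
    · have h0 : M.obsLik z b a = 0 := le_antisymm (not_lt.1 hz) (M.aux_obsLik_nonneg b hb a z)
      unfold obsLik at h0
      rw [Finset.sum_eq_zero_iff_of_nonneg (fun x _ =>
        mul_nonneg (M.aux_prop_nonneg b hb a x) (M.aux_Ob_nonneg x z))] at h0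
      exact (h0 x (Finset.mem_univ x)).symm
  rw [Finset.sum_filter, Finset.sum_congr rfl (fun z _ => h z), ← Finset.mul_sum,
    aux_Ob_sum, mul_one]

theorem aux_W_step (M : POMDP X A Z) (n : ℕ)
    (ih : ∀ b : X → ℝ, (∀ x, 0 ≤ b x) → M.W n b ≤ M.V n b)
    (b : X → ℝ) (hb : ∀ x, 0 ≤ b x) (a : A) :
    M.W n (M.prop b a) ≤ ∑ z ∈ Finset.univ.filter (fun z => 0 < M.obsLik z b a),
        M.obsLik z b a * V M n (M.post b a z) := by
  have h : M.prop b a = fun x => ∑ z ∈ Finset.univ.filter (fun z => 0 < M.obsLik z b a),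
      M.obsLik z b a * M.post b a z x := by
    funext x; exact (M.aux_decomp b hb a x).symm
  rw [h]
  refine (M.aux_W_sub _ (fun z => M.obsLik z b a)
    (fun z _ => M.aux_obsLik_nonneg b hb a z) n (fun z => M.post b a z)).trans ?_
  exact Finset.sum_le_sum fun z _ => mul_le_mul_of_nonneg_left
    (ih _ (M.aux_post_nonneg b hb a z)) (M.aux_obsLik_nonneg b hb a z)

theorem aux_W_le_V (M : POMDP X A Z) (n : ℕ) :
    ∀ b : X → ℝ, (∀ x, 0 ≤ b x) → M.W n b ≤ M.V n b := by
  induction n with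
  | zero => intro b _; simp [W, V]
  | succ n ih =>
    intro b hb
    rw [W, V]
    refine Finset.sup'_mono_fun fun a _ => ?_
    exact add_le_add_right (M.aux_W_step n ih b hb a) _

theorem aux_U_nonneg (M : POMDP X A Z) (hr : ∀ x a, 0 ≤ M.r x a) (n : ℕ) :
    ∀ x, 0 ≤ M.U n x := by
  induction n with
  | zero => intro x; simp [U]
  | succ n ih =>
    intro x
    rw [U]
    obtain ⟨a⟩ := ‹Nonempty A›
    refine le_trans ?_ (Finset.le_sup' _ (Finset.mem_univ a))
    exact add_nonneg (hr x a)
      (Finset.sum_nonneg fun y _ => mul_nonneg (M.aux_Tr_nonneg _ _ _) (ih y))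

theorem aux_V_step (M : POMDP X A Z) (n : ℕ)
    (ih : ∀ b : X → ℝ, (∀ x, 0 ≤ b x) → M.V n b ≤ ∑ x, b x * M.U n x)
    (b : X → ℝ) (hb : ∀ x, 0 ≤ b x) (a : A) :
    ∑ z ∈ Finset.univ.filter (fun z => 0 < M.obsLik z b a),
        M.obsLik z b a * V M n (M.post b a z) ≤ ∑ x', M.prop b a x' * M.U n x' := by
  refine (Finset.sum_le_sum fun z _ => mul_le_mul_of_nonneg_left
    (ih _ (M.aux_post_nonneg b hb a z)) (M.aux_obsLik_nonneg b hb a z)).trans (le_of_eq ?_)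
  simp only [Finset.mul_sum]
  rw [Finset.sum_comm]
  refine Finset.sum_congr rfl fun x _ => ?_
  rw [← M.aux_decomp b hb a x, Finset.sum_mul]
  simp only [mul_assoc]

theorem aux_V_le_U (M : POMDP X A Z) (n : ℕ) :
    ∀ b : X → ℝ, (∀ x, 0 ≤ b x) → M.V n b ≤ ∑ x, b x * M.U n x := by
  induction n with
  | zero => intro b _; simp [U, V]
  | succ n ih =>
    intro b hb
    rw [V]
    refine Finset.sup'_le _ _ fun a _ => ?_
    refine (add_le_add_right (M.aux_V_step n ih b hb a) _).trans ?_
    rw [aux_prop_mul, Rew, ← Finset.sum_add_distrib]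
    refine Finset.sum_le_sum fun x _ => ?_
    rw [← mul_add]
    refine mul_le_mul_of_nonneg_left ?_ (hb x)
    rw [U]
    exact Finset.le_sup' (fun a => M.r x a + ∑ x', M.Tr x a x' * M.U n x') (Finset.mem_univ a)

/-- One filtering step preserves the two-sided density comparison. -/
theorem aux_step (M : POMDP X A Z) (φ b : X → ℝ) (a : A) (z : Z) (Zb : Set Z) (hz : z ∈ Zb)
    (C : ℝ) (hC : 0 < C) (hφ : ∀ x, 0 ≤ φ x) (hb : IsBelief b)
    (h1 : ∀ x, C * φ x ≤ b x) (h2 : ∀ x, C * b x ≤ φ x)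
    (hobs : ∀ x, 0 < M.prop φ a x → ∀ z ∈ Zb, 0 < M.Ob x z) :
    0 < M.obsLik z b a ∧ IsBelief (M.post b a z) ∧
    0 < sInf (Set.image2 M.Ob {x | 0 < M.prop φ a x} Zb) /
      sSup (Set.image2 M.Ob {x | 0 < M.prop φ a x} Zb) ∧
    (∀ x, C * (sInf (Set.image2 M.Ob {x | 0 < M.prop φ a x} Zb) /
      sSup (Set.image2 M.Ob {x | 0 < M.prop φ a x} Zb)) * M.prop φ a x ≤ M.post b a z x) ∧
    (∀ x, C * (sInf (Set.image2 M.Ob {x | 0 < M.prop φ a x} Zb) /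
      sSup (Set.image2 M.Ob {x | 0 < M.prop φ a x} Zb)) * M.post b a z x ≤ M.prop φ a x) := by
  set S := Set.image2 M.Ob {x | 0 < M.prop φ a x} Zb with hS
  have g1 := M.aux_prop_mono C b φ h1 a
  have g2 := M.aux_prop_mono C φ b h2 a
  have p0 := M.aux_prop_nonneg b hb.1 a
  have q0 := M.aux_prop_nonneg φ hφ a
  have psum : ∑ x, M.prop b a x = 1 := by rw [aux_prop_sum, hb.2]
  have hfin : S.Finite := Set.Finite.image2 _ (Set.toFinite _) (Set.toFinite _)
  have hlo : ∀ x, 0 < M.prop φ a x → sInf S ≤ M.Ob x z := fun x hx =>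
    csInf_le hfin.bddBelow (Set.mem_image2_of_mem hx hz)
  have hhi : ∀ x, 0 < M.prop φ a x → M.Ob x z ≤ sSup S := fun x hx =>
    le_csSup hfin.bddAbove (Set.mem_image2_of_mem hx hz)
  obtain ⟨x₀, hx₀⟩ : ∃ x, 0 < M.prop φ a x := by
    by_contra! hcon
    have : ∑ x, M.prop b a x ≤ 0 := Finset.sum_nonpos fun x _ => by
      have := g2 x
      have := hcon x
      nlinarith [p0 x]
    linarith
  have hne : S.Nonempty := ⟨_, Set.mem_image2_of_mem hx₀ hz⟩
  have hm : 0 < sInf S := by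
    obtain ⟨x, hx, w, hw, he⟩ := hne.csInf_mem hfin
    rw [← he]
    exact hobs x hx w hw
  have hMx : 0 < sSup S := hm.trans_le ((hlo x₀ hx₀).trans (hhi x₀ hx₀))
  have pz : ∀ x, ¬ 0 < M.prop φ a x → M.prop b a x = 0 := fun x hx => by
    have := g2 x
    have := p0 x
    nlinarith
  have hPlo : sInf S ≤ M.obsLik z b a := by
    have : sInf S = ∑ x, M.prop b a x * sInf S := by rw [← Finset.sum_mul, psum, one_mul]
    rw [this]
    refine Finset.sum_le_sum fun x _ => ?_
    by_cases hx : 0 < M.prop φ a x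
    · exact mul_le_mul_of_nonneg_left (hlo x hx) (p0 x)
    · simp [pz x hx]
  have hPhi : M.obsLik z b a ≤ sSup S := by
    have : sSup S = ∑ x, M.prop b a x * sSup S := by rw [← Finset.sum_mul, psum, one_mul]
    rw [this]
    refine Finset.sum_le_sum fun x _ => ?_
    by_cases hx : 0 < M.prop φ a x
    · exact mul_le_mul_of_nonneg_left (hhi x hx) (p0 x)
    · simp [pz x hx]
  have hP : 0 < M.obsLik z b a := hm.trans_le hPlo
  refine ⟨hP, ⟨M.aux_post_nonneg b hb.1 a z, ?_⟩, div_pos hm hMx, fun x => ?_, fun x => ?_⟩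
  · unfold post
    rw [← Finset.sum_div, div_eq_one_iff_eq hP.ne', obsLik]
    exact Finset.sum_congr rfl fun x _ => mul_comm _ _
  · by_cases hx : 0 < M.prop φ a x
    · calc C * (sInf S / sSup S) * M.prop φ a x
          = (sInf S / sSup S) * (C * M.prop φ a x) := by ring
        _ ≤ (M.Ob x z / M.obsLik z b a) * M.prop b a x := by
          refine mul_le_mul ?_ (g1 x) (by positivity)
            (div_nonneg (M.aux_Ob_nonneg x z) hP.le)
          exact div_le_div₀ (M.aux_Ob_nonneg x z) (hlo x hx) hP hPhi
        _ = _ := by unfold post; ring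
    · have : M.prop φ a x = 0 := le_antisymm (not_lt.1 hx) (q0 x)
      rw [this, mul_zero]
      exact M.aux_post_nonneg b hb.1 a z x
  · by_cases hx : 0 < M.prop φ a x
    · have hr1 : (sInf S / sSup S) * (M.Ob x z / M.obsLik z b a) ≤ 1 := by
        rw [div_mul_div_comm, div_le_one (by positivity), mul_comm]
        exact mul_le_mul (hhi x hx) hPlo hm.le hMx.le
      calc C * (sInf S / sSup S) * M.post b a z x
          = ((sInf S / sSup S) * (M.Ob x z / M.obsLik z b a)) * (C * M.prop b a x) := by
            unfold post; ring
        _ ≤ 1 * (C * M.prop b a x) :=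
          mul_le_mul_of_nonneg_right hr1 (mul_nonneg hC.le (p0 x))
        _ ≤ _ := by rw [one_mul]; exact g2 x
    · have : M.post b a z x = 0 := by simp [post, pz x hx]
      rw [this, mul_zero]
      exact q0 x

theorem aux_inv (M : POMDP X A Z) (b₀ : X → ℝ) (hb₀ : IsBelief b₀) (k : ℕ) :
    ∀ (a : Fin k → A) (Zbar : Fin k → Set Z) (φ : Fin (k + 1) → X → ℝ)
    (_ : φ 0 = b₀)
    (_ : ∀ j : Fin k, φ j.succ = M.prop (φ j.castSucc) (a j))
    (_ : ∀ j : Fin k, ∀ x : X, 0 < φ j.succ x → ∀ z ∈ Zbar j, 0 < M.Ob x z)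
    (z : Fin k → Z) (_ : ∀ j : Fin k, z j ∈ Zbar j) (bp : Fin (k + 1) → X → ℝ)
    (_ : bp 0 = b₀)
    (_ : ∀ j : Fin k, bp j.succ = M.post (bp j.castSucc) (a j) (z j))
    (C : ℝ) (_ : C = ∏ j : Fin k,
                sInf (Set.image2 M.Ob {x | 0 < φ j.succ x} (Zbar j)) /
                  sSup (Set.image2 M.Ob {x | 0 < φ j.succ x} (Zbar j))),
    (∀ j : Fin k, 0 < M.obsLik (z j) (bp j.castSucc) (a j)) ∧ 0 < C ∧
    IsBelief (bp (Fin.last k)) ∧ (∀ x, 0 ≤ φ (Fin.last k) x) ∧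
    (∀ x, C * φ (Fin.last k) x ≤ bp (Fin.last k) x) ∧
    (∀ x, C * bp (Fin.last k) x ≤ φ (Fin.last k) x) := by
  induction k with
  | zero =>
    intro a Zbar φ hφ0 hφ hobs z hz bp hbp0 hbp C hC
    have e : Fin.last 0 = 0 := rfl
    rw [e, hφ0, hbp0]
    simp at hC
    subst hC
    exact ⟨fun j => j.elim0, one_pos, hb₀, hb₀.1, fun x => by simp, fun x => by simp⟩
  | succ k ih =>
    intro a Zbar φ hφ0 hφ hobs z hz bp hbp0 hbp C hC
    rw [Fin.prod_univ_castSucc] at hC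
    obtain ⟨i1, i2, i3, i4, i5, i6⟩ := ih (fun j => a j.castSucc) (fun j => Zbar j.castSucc)
      (fun j => φ j.castSucc) hφ0 (fun j => hφ j.castSucc) (fun j => hobs j.castSucc)
      (fun j => z j.castSucc) (fun j => hz j.castSucc) (fun j => bp j.castSucc) hbp0
      (fun j => hbp j.castSucc) _ rfl
    have hl := hφ (Fin.last k)
    have hbl := hbp (Fin.last k)
    have ho := hobs (Fin.last k)
    rw [hl] at ho
    obtain ⟨s1, s2, s3, s4, s5⟩ := M.aux_step _ _ (a (Fin.last k)) (z (Fin.last k)) _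
      (hz (Fin.last k)) _ i2 i4 i3 i5 i6 ho
    rw [← hl] at s3 s4 s5
    rw [← hbl] at s2 s4 s5
    subst hC
    refine ⟨fun j => ?_, mul_pos i2 s3, s2, ?_, s4, s5⟩
    · refine Fin.lastCases s1 (fun j => i1 j) j
    · intro x
      rw [← Fin.succ_last, hl]
      exact M.aux_prop_nonneg _ i4 _ x

end aux

end POMDP

/-- Theorem 5: refined bounds under allowed observation
sets `Z̄_j`: for every observation sequence with `z_j ∈ Z̄_j`, the posterior
beliefs are well-defined and the closed-loop optimal Q-value at the final
posterior belief is sandwiched between `C̄_k` times the open-loop Q-value and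
`(1 / C̄_k)` times the QMDP Q-value at the open-loop propagated belief. -/
theorem skip_replanning_bounds_allowed_obs {X A Z : Type}
    [Fintype X] [Fintype A] [Fintype Z]
    [Nonempty X] [Nonempty A] [Nonempty Z]
    (M : POMDP X A Z) (hr : ∀ (x : X) (a : A), 0 ≤ M.r x a)
    (k : ℕ) (hk : 1 ≤ k)
    (b₀ : X → ℝ) (hb₀ : POMDP.IsBelief b₀)
    (a : Fin k → A) (Zbar : Fin k → Set Z)
    (φ : Fin (k + 1) → X → ℝ)
    (hφ0 : φ 0 = b₀)
    (hφ : ∀ j : Fin k, φ j.succ = M.prop (φ j.castSucc) (a j))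
    (hobs : ∀ j : Fin k, ∀ x : X, 0 < φ j.succ x → ∀ z ∈ Zbar j, 0 < M.Ob x z) :
    ∀ (z : Fin k → Z), (∀ j : Fin k, z j ∈ Zbar j) →
      ∀ bp : Fin (k + 1) → X → ℝ,
        bp 0 = b₀ →
        (∀ j : Fin k, bp j.succ = M.post (bp j.castSucc) (a j) (z j)) →
        (∀ j : Fin k, 0 < M.obsLik (z j) (bp j.castSucc) (a j)) ∧
          ∀ L : ℕ, 1 ≤ L → ∀ aₖ : A,
            (∏ j : Fin k,
                sInf (Set.image2 M.Ob {x | 0 < φ j.succ x} (Zbar j)) /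
                  sSup (Set.image2 M.Ob {x | 0 < φ j.succ x} (Zbar j))) *
              M.QOL L (φ (Fin.last k)) aₖ ≤ M.Q L (bp (Fin.last k)) aₖ ∧
            M.Q L (bp (Fin.last k)) aₖ ≤
              (1 /
                  ∏ j : Fin k,
                    sInf (Set.image2 M.Ob {x | 0 < φ j.succ x} (Zbar j)) /
                      sSup (Set.image2 M.Ob {x | 0 < φ j.succ x} (Zbar j))) *
                M.QFO L (φ (Fin.last k)) aₖ := by
  intro z hz bp hbp0 hbp
  obtain ⟨i1, i2, i3, i4, i5, i6⟩ :=
    M.aux_inv b₀ hb₀ k a Zbar φ hφ0 hφ hobs z hz bp hbp0 hbp _ rfl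
  refine ⟨i1, fun L hL aₖ => ?_⟩
  obtain ⟨n, rfl⟩ : ∃ n, L = n + 1 := ⟨L - 1, by omega⟩
  generalize (∏ j : Fin k, sInf (Set.image2 M.Ob {x | 0 < φ j.succ x} (Zbar j)) /
    sSup (Set.image2 M.Ob {x | 0 < φ j.succ x} (Zbar j))) = C at *
  constructor
  · rw [POMDP.QOL, POMDP.Q, mul_add]
    refine add_le_add (M.aux_Rew_mono hr C _ _ i5 aₖ) ?_
    exact (M.aux_W_mono hr C n _ _ (M.aux_prop_mono C _ _ i5 aₖ)).trans
      (M.aux_W_step n (M.aux_W_le_V n) _ i3.1 aₖ)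
  · rw [POMDP.QFO, POMDP.Q, one_div, le_inv_mul_iff₀ i2, mul_add]
    refine add_le_add (M.aux_Rew_mono hr C _ _ i6 aₖ) ?_
    refine (mul_le_mul_of_nonneg_left
      (M.aux_V_step n (M.aux_V_le_U n) _ i3.1 aₖ) i2.le).trans ?_
    rw [Finset.mul_sum]
    refine Finset.sum_le_sum fun x _ => ?_
    rw [← mul_assoc]
    exact mul_le_mul_of_nonneg_right (M.aux_prop_mono C _ _ i6 aₖ x) (M.aux_U_nonneg hr n x)
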